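/- Let 𝓕 be a finite family of non-invariant linear forms, each in at least three variables. Then d_𝓕(ℤ/p) converges to d_𝓕(𝕋) as p → ∞ over primes, and d_𝓕(𝕋) > 0. -/

import Mathlib

open MeasureTheory
noncomputable section

/-- `A` is `L`-free for the form with coefficients `c`. -/
def IsLFree {G : Type*} [AddCommGroup G] {t : ℕ} (c : Fin t → ℤ) (A : Set G) : Prop :=
  ¬∃ x : Fin t → G, (∀ i, x i ∈ A) ∧ ∑ i, c i • x i = 0

/-- The maximal density of a measurable `𝓕`-free subset, for the family of forms
`𝓕 = (c i)_{i : Fin n}`, where `c i` has `t i` variables. -/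
def dF {G : Type*} [AddCommGroup G] [MeasurableSpace G] (μ : Measure G)
    {n : ℕ} {t : Fin n → ℕ} (c : ∀ i, Fin (t i) → ℤ) : ℝ :=
  sSup {r : ℝ | ∃ A : Set G, MeasurableSet A ∧ (∀ i, IsLFree (c i) A) ∧ r = (μ A).toReal}

/-- The maximal density of an `𝓕`-free subset of `ℤ/p`. -/
def dZ (p : ℕ) {n : ℕ} {t : Fin n → ℕ} (c : ∀ i, Fin (t i) → ℤ) : ℝ :=
  sSup {r : ℝ | ∃ A : Set (ZMod p), (∀ i, IsLFree (c i) A) ∧ r = (Nat.card A : ℝ) / p}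

section FourierAnalysis

variable {p : ℕ} [Fact p.Prime]

/-- The function on `ℤ/p` with Fourier coefficients `a`. -/
def trigPoly (a : ZMod p → ℂ) (x : ZMod p) : ℂ := ∑ r, a r * ZMod.stdAddChar (r * x)

/-- The normalised Fourier coefficients of a function on `ℤ/p`. -/
def fourierCoef (f : ZMod p → ℂ) (r : ZMod p) : ℂ :=
  (p : ℂ)⁻¹ * ∑ x, f x * ZMod.stdAddChar (-(r * x))

theorem norm_stdAddChar (x : ZMod p) : ‖(ZMod.stdAddChar x : ℂ)‖ = 1 :=
  AddChar.norm_apply _ _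

theorem sum_stdAddChar_mul (b : ZMod p) :
    ∑ x : ZMod p, (ZMod.stdAddChar (x * b) : ℂ) = if b = 0 then (p : ℂ) else 0 := by
  rw [AddChar.sum_mulShift b (ZMod.isPrimitive_stdAddChar p), ZMod.card]
  split_ifs <;> simp

theorem sum_norm_sq_trigPoly (a : ZMod p → ℂ) :
    ∑ x, ‖trigPoly a x‖ ^ 2 = p * ∑ r, ‖a r‖ ^ 2 := by
  have key : ∑ x, trigPoly a x * (starRingEnd ℂ) (trigPoly a x)
      = p * ∑ r, a r * (starRingEnd ℂ) (a r) := by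
    have h1 : ∀ x, trigPoly a x * (starRingEnd ℂ) (trigPoly a x)
        = ∑ r, ∑ s, a r * (starRingEnd ℂ) (a s) * ZMod.stdAddChar (x * (r - s)) := by
      intro x
      rw [trigPoly, map_sum, Finset.sum_mul_sum]
      refine Finset.sum_congr rfl fun r _ => Finset.sum_congr rfl fun s _ => ?_
      rw [map_mul (starRingEnd ℂ), ← AddChar.map_neg_eq_conj, mul_mul_mul_comm,
        ← AddChar.map_add_eq_mul]
      congr 2
      ring
    simp_rw [h1]
    rw [Finset.sum_comm, Finset.mul_sum]
    refine Finset.sum_congr rfl fun r _ => ?_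
    rw [Finset.sum_comm, Finset.sum_eq_single r]
    · rw [← Finset.mul_sum, sum_stdAddChar_mul]
      simp [mul_comm]
    · intro s _ hs
      rw [← Finset.mul_sum, sum_stdAddChar_mul, if_neg (sub_ne_zero.mpr hs.symm), mul_zero]
    · simp
  simp_rw [Complex.mul_conj'] at key
  exact_mod_cast key

theorem trigPoly_fourierCoef (f : ZMod p → ℂ) (x : ZMod p) : trigPoly (fourierCoef f) x = f x := by
  have hp : (p : ℂ) ≠ 0 := by exact_mod_cast (Fact.out : p.Prime).ne_zero
  have h1 : ∀ r, fourierCoef f r * ZMod.stdAddChar (r * x)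
      = ∑ y, (p : ℂ)⁻¹ * f y * ZMod.stdAddChar (r * (x - y)) := by
    intro r
    rw [fourierCoef, mul_assoc, Finset.sum_mul, Finset.mul_sum]
    refine Finset.sum_congr rfl fun y _ => ?_
    rw [mul_assoc (f y), ← AddChar.map_add_eq_mul, ← mul_assoc]
    congr 2
    ring
  simp_rw [trigPoly, h1]
  rw [Finset.sum_comm, Finset.sum_eq_single x]
  · rw [← Finset.mul_sum, sum_stdAddChar_mul]
    rw [sub_self, if_pos rfl]
    field_simp
  · intro y _ hy
    rw [← Finset.mul_sum, sum_stdAddChar_mul, if_neg (sub_ne_zero.mpr hy.symm), mul_zero]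
  · simp

theorem sum_norm_sq_fourierCoef_le (f : ZMod p → ℂ) (hf : ∀ x, ‖f x‖ ≤ 1) :
    ∑ r, ‖fourierCoef f r‖ ^ 2 ≤ 1 := by
  have hp : (0 : ℝ) < p := by exact_mod_cast (Fact.out : p.Prime).pos
  have h := sum_norm_sq_trigPoly (fourierCoef f)
  simp_rw [trigPoly_fourierCoef] at h
  have h2 : ∑ x, ‖f x‖ ^ 2 ≤ p := by
    calc ∑ x, ‖f x‖ ^ 2 ≤ ∑ _x : ZMod p, (1 : ℝ) :=
          Finset.sum_le_sum fun x _ => pow_le_one₀ (norm_nonneg _) (hf x)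
      _ = p := by simp [ZMod.card]
  rw [h] at h2
  exact le_of_mul_le_mul_left (by linarith) hp

theorem norm_fourierCoef_le_one (f : ZMod p → ℂ) (hf : ∀ x, ‖f x‖ ≤ 1) (r : ZMod p) :
    ‖fourierCoef f r‖ ≤ 1 := by
  have h := (Finset.single_le_sum (f := fun r => ‖fourierCoef f r‖ ^ 2)
    (fun _ _ => by positivity) (Finset.mem_univ r)).trans (sum_norm_sq_fourierCoef_le f hf)
  exact (sq_le_one_iff₀ (norm_nonneg _)).mp h

theorem sum_norm_sq_trigPoly_dilate_le (B : Finset (ZMod p)) (u : ZMod p → ℂ)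
    (hu : ∀ x, ‖u x‖ ≤ 1) (m : ZMod p) (hm : m ≠ 0) :
    ∑ r, ‖∑ α ∈ B, u α * ZMod.stdAddChar (r * (m * α))‖ ^ 2 ≤ p * (B.card : ℝ) := by
  classical
  have h1 : ∀ r, ∑ α ∈ B, u α * (ZMod.stdAddChar (r * (m * α)) : ℂ)
      = trigPoly (fun α => if α ∈ B then u α else 0) (r * m) := by
    intro r
    simp only [trigPoly, ite_mul, zero_mul, Finset.sum_ite_mem, Finset.univ_inter]
    refine Finset.sum_congr rfl fun α _ => ?_
    congr 2
    ring
  simp_rw [h1]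
  rw [(mulRight_bijective₀ m hm).sum_comp
    (fun s => ‖trigPoly (fun α => if α ∈ B then u α else 0) s‖ ^ 2), sum_norm_sq_trigPoly]
  refine mul_le_mul_of_nonneg_left ?_ (by positivity)
  calc ∑ r, ‖if r ∈ B then u r else 0‖ ^ 2 ≤ ∑ r : ZMod p, if r ∈ B then (1 : ℝ) else 0 := by
        refine Finset.sum_le_sum fun r _ => ?_
        split_ifs
        · exact pow_le_one₀ (norm_nonneg _) (hu r)
        · simp
    _ = B.card := by simp

theorem norm_bilinear_trigPoly_le (B : Finset (ZMod p)) (a u v : ZMod p → ℂ) {η : ℝ}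
    (hη : 0 ≤ η) (ha : ∀ r, ‖a r‖ ≤ η) (hu : ∀ x, ‖u x‖ ≤ 1) (hv : ∀ x, ‖v x‖ ≤ 1)
    (m : ZMod p) (hm : m ≠ 0) (x : ZMod p) :
    ‖∑ α ∈ B, ∑ β ∈ B, trigPoly a (x + m * (α - β)) * u α * v β‖ ≤ η * p * B.card := by
  have h1 : ∑ α ∈ B, ∑ β ∈ B, trigPoly a (x + m * (α - β)) * u α * v β
      = ∑ r, a r * ZMod.stdAddChar (r * x) * (∑ α ∈ B, u α * ZMod.stdAddChar (r * (m * α)))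
        * (∑ β ∈ B, v β * ZMod.stdAddChar (r * (-m * β))) := by
    have h2 : ∀ r, a r * ZMod.stdAddChar (r * x)
          * (∑ α ∈ B, u α * (ZMod.stdAddChar (r * (m * α)) : ℂ))
          * (∑ β ∈ B, v β * ZMod.stdAddChar (r * (-m * β)))
        = ∑ α ∈ B, ∑ β ∈ B, a r * ZMod.stdAddChar (r * (x + m * (α - β))) * u α * v β := by
      intro r
      rw [mul_assoc, Finset.sum_mul_sum, Finset.mul_sum]
      refine Finset.sum_congr rfl fun α _ => ?_
      rw [Finset.mul_sum]
      refine Finset.sum_congr rfl fun β _ => ?_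
      have h3 : r * (x + m * (α - β)) = r * x + r * (m * α) + r * (-m * β) := by ring
      rw [h3, AddChar.map_add_eq_mul, AddChar.map_add_eq_mul]
      ring
    simp_rw [h2, trigPoly, Finset.sum_mul]
    rw [Finset.sum_comm]
    conv_rhs => rw [Finset.sum_comm]
    rw [Finset.sum_comm]
    refine Finset.sum_congr rfl fun α _ => ?_
    rw [Finset.sum_comm]
  rw [h1]
  have hU := sum_norm_sq_trigPoly_dilate_le B u hu m hm
  have hV := sum_norm_sq_trigPoly_dilate_le B v hv (-m) (neg_ne_zero.mpr hm)
  calc _ ≤ ∑ r, η * ((‖∑ α ∈ B, u α * ZMod.stdAddChar (r * (m * α))‖ ^ 2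
          + ‖∑ β ∈ B, v β * ZMod.stdAddChar (r * (-m * β))‖ ^ 2) / 2) := by
        refine norm_sum_le_of_le _ fun r _ => ?_
        rw [norm_mul, norm_mul, norm_mul, norm_stdAddChar, mul_one, mul_assoc]
        refine mul_le_mul (ha r) ?_ (by positivity) hη
        nlinarith [sq_nonneg (‖∑ α ∈ B, u α * (ZMod.stdAddChar (r * (m * α)) : ℂ)‖
          - ‖∑ β ∈ B, v β * (ZMod.stdAddChar (r * (-m * β)) : ℂ)‖)]
    _ = η * ((∑ r, ‖∑ α ∈ B, u α * ZMod.stdAddChar (r * (m * α))‖ ^ 2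
          + ∑ r, ‖∑ β ∈ B, v β * ZMod.stdAddChar (r * (-m * β))‖ ^ 2) / 2) := by
        rw [← Finset.mul_sum, ← Finset.sum_div, Finset.sum_add_distrib]
    _ ≤ η * (p * B.card) := mul_le_mul_of_nonneg_left (by linarith) hη
    _ = η * p * B.card := by ring

theorem sum_norm_trigPoly_le (a : ZMod p → ℂ) {δ : ℝ} (hδ : 0 ≤ δ)
    (ha : ∑ r, ‖a r‖ ^ 2 ≤ δ ^ 2) : ∑ x, ‖trigPoly a x‖ ≤ δ * p := by
  have hp : (0 : ℝ) ≤ p := by positivity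
  refine abs_le_of_sq_le_sq' ?_ (by positivity) |>.2
  calc (∑ x, ‖trigPoly a x‖) ^ 2 ≤ (Finset.univ : Finset (ZMod p)).card * ∑ x, ‖trigPoly a x‖ ^ 2 :=
        sq_sum_le_card_mul_sum_sq
    _ = p * (p * ∑ r, ‖a r‖ ^ 2) := by rw [sum_norm_sq_trigPoly, Finset.card_univ, ZMod.card]
    _ ≤ p * (p * δ ^ 2) := by gcongr
    _ = (δ * p) ^ 2 := by ring

theorem norm_stdAddChar_neg_sub_one (y : ZMod p) :
    ‖(ZMod.stdAddChar (-y) : ℂ) - 1‖ = ‖(ZMod.stdAddChar y : ℂ) - 1‖ := by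
  have h : (ZMod.stdAddChar (-y) : ℂ) - 1
      = -(ZMod.stdAddChar (-y) * ((ZMod.stdAddChar y : ℂ) - 1)) := by
    rw [mul_sub, ← AddChar.map_add_eq_mul]
    simp
  rw [h, norm_neg, norm_mul, norm_stdAddChar, one_mul]

theorem norm_stdAddChar_add_sub_one_le (y z : ZMod p) :
    ‖(ZMod.stdAddChar (y + z) : ℂ) - 1‖
      ≤ ‖(ZMod.stdAddChar y : ℂ) - 1‖ + ‖(ZMod.stdAddChar z : ℂ) - 1‖ := by
  have h : (ZMod.stdAddChar (y + z) : ℂ) - 1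
      = (ZMod.stdAddChar y - 1) + ZMod.stdAddChar y * (ZMod.stdAddChar z - 1) := by
    rw [AddChar.map_add_eq_mul]
    ring
  rw [h]
  refine (norm_add_le _ _).trans ?_
  rw [norm_mul, norm_stdAddChar, one_mul]

theorem norm_stdAddChar_nat_mul_sub_one_le (n : ℕ) (y : ZMod p) :
    ‖(ZMod.stdAddChar ((n : ZMod p) * y) : ℂ) - 1‖ ≤ n * ‖(ZMod.stdAddChar y : ℂ) - 1‖ := by
  induction n with
  | zero => simp
  | succ n ih =>
    push_cast
    rw [add_mul, one_mul, add_mul, one_mul]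
    exact (norm_stdAddChar_add_sub_one_le _ _).trans (by gcongr)

theorem norm_stdAddChar_int_mul_sub_one_le (n : ℤ) (y : ZMod p) :
    ‖(ZMod.stdAddChar ((n : ZMod p) * y) : ℂ) - 1‖ ≤ |(n : ℝ)| * ‖(ZMod.stdAddChar y : ℂ) - 1‖ := by
  obtain ⟨k, rfl | rfl⟩ := n.eq_nat_or_neg
  · simpa using norm_stdAddChar_nat_mul_sub_one_le k y
  · have := norm_stdAddChar_nat_mul_sub_one_le k y
    rw [← norm_stdAddChar_neg_sub_one] at this
    simpa using this

theorem norm_trigPoly_add_sub_le (a : ZMod p → ℂ) (Λ : Finset (ZMod p)) {ρ : ℝ}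
    (ha : ∀ r, ‖a r‖ ≤ 1) (hΛ : ∀ r ∉ Λ, a r = 0) (x y : ZMod p)
    (hy : ∀ r ∈ Λ, ‖(ZMod.stdAddChar (r * y) : ℂ) - 1‖ ≤ ρ) :
    ‖trigPoly a (x + y) - trigPoly a x‖ ≤ Λ.card * ρ := by
  have h : trigPoly a (x + y) - trigPoly a x
      = ∑ r ∈ Λ, a r * ZMod.stdAddChar (r * x) * (ZMod.stdAddChar (r * y) - 1) := by
    rw [trigPoly, trigPoly, ← Finset.sum_sub_distrib]
    symm
    refine Finset.sum_subset_zero_on_sdiff (Finset.subset_univ _) ?_ ?_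
    · intro r hr
      simp [hΛ r (by simpa using hr)]
    · intro r _
      rw [mul_add, AddChar.map_add_eq_mul]
      ring
  rw [h, ← nsmul_eq_mul]
  refine (norm_sum_le_of_le _ fun r hr => ?_).trans_eq (Finset.sum_const _)
  rw [norm_mul, norm_mul, norm_stdAddChar, mul_one]
  exact (mul_le_of_le_one_left (norm_nonneg _) (ha r)).trans (hy r hr)

end FourierAnalysis

/-- Pigeonhole form of the lower bound for the size of a Bohr set: any `d` characters of `ℤ/p` are
simultaneously almost constant on a set of positive density. -/
theorem exists_bohr_fiber {ρ : ℝ} (hρ : 0 < ρ) (d : ℕ) :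
    ∃ κ : ℝ, 0 < κ ∧ ∀ (p : ℕ) [Fact p.Prime] (Λ : Finset (ZMod p)), Λ.card ≤ d →
      ∃ B : Finset (ZMod p), κ * p ≤ B.card ∧ ∀ a ∈ B, ∀ b ∈ B, ∀ r ∈ Λ,
        ‖(ZMod.stdAddChar (r * (a - b)) : ℂ) - 1‖ ≤ ρ := by
  classical
  obtain ⟨t, -, htfin, hcov⟩ :=
    finite_cover_balls_of_compact (isCompact_closedBall (0 : ℂ) 1) (half_pos hρ)
  have hcov' : ∀ z : ℂ, ‖z‖ = 1 → ∃ y : t, dist z y < ρ / 2 := by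
    intro z hz
    have := hcov (show z ∈ Metric.closedBall (0 : ℂ) 1 by simp [hz])
    simpa using this
  have : Fintype t := htfin.fintype
  obtain ⟨y0, -⟩ := hcov' 1 (by simp)
  have : Nonempty t := ⟨y0⟩
  have hq : 0 < Fintype.card t := Fintype.card_pos
  refine ⟨((Fintype.card t : ℝ) ^ d)⁻¹, by positivity, ?_⟩
  intro p _ Λ hΛ
  choose F hF using fun (x : ZMod p) (r : Λ) =>
    hcov' (ZMod.stdAddChar (r.1 * x) : ℂ) (norm_stdAddChar _)
  obtain ⟨y, hy⟩ := Fintype.exists_le_card_fiber_of_nsmul_le_card (f := F)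
    (b := ((Fintype.card t : ℝ) ^ d)⁻¹ * p) (by
      rw [nsmul_eq_mul, Fintype.card_fun, Fintype.card_coe, ZMod.card, ← mul_assoc]
      refine mul_le_of_le_one_left (by positivity) ?_
      rw [← div_eq_mul_inv, div_le_one (by positivity)]
      push_cast
      exact pow_le_pow_right₀ (by exact_mod_cast hq) hΛ)
  refine ⟨_, hy, ?_⟩
  intro a ha b hb r hr
  simp only [Finset.mem_filter, Finset.mem_univ, true_and] at ha hb
  have h1 := hF a ⟨r, hr⟩
  have h2 := hF b ⟨r, hr⟩
  rw [ha] at h1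
  rw [hb] at h2
  have h3 : (ZMod.stdAddChar (r * (a - b)) : ℂ) - 1
      = ZMod.stdAddChar (-(r * b)) * (ZMod.stdAddChar (r * a) - ZMod.stdAddChar (r * b)) := by
    rw [mul_sub, mul_sub, ← AddChar.map_add_eq_mul, ← AddChar.map_add_eq_mul, neg_add_cancel,
      AddChar.map_zero_eq_one, neg_add_eq_sub]
  rw [h3, norm_mul, norm_stdAddChar, one_mul, ← dist_eq_norm]
  have := dist_triangle_right (ZMod.stdAddChar (r * a) : ℂ) (ZMod.stdAddChar (r * b)) (y ⟨r, hr⟩)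
  linarith

/-- A strong regularity lemma: a bounded function on `ℤ/p` is the sum of a function which is almost
invariant under differences from `B`, a function which is small in mean, and a function
which is small when tested against products on `B × B`. -/
theorem exists_regularity_decomposition {δ : ℝ} (hδ : 0 < δ) (D : ℕ) :
    ∃ P : ℕ, ∀ (p : ℕ) [Fact p.Prime], P ≤ p → ∀ f : ZMod p → ℂ, (∀ x, ‖f x‖ ≤ 1) →
      ∃ (F₁ F₂ F₃ : ZMod p → ℂ) (B : Finset (ZMod p)), 1 < B.card ∧
        (∀ x, f x = F₁ x + F₂ x + F₃ x) ∧
        (∀ s m : ℤ, |s| ≤ D → |m| ≤ D → ∀ a ∈ B, ∀ b ∈ B, ∀ a' ∈ B, ∀ b' ∈ B, ∀ x,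
          ‖F₁ (x + (s * (a - b) + m * (a' - b'))) - F₁ x‖ ≤ δ) ∧
        ∑ x, ‖F₂ x‖ ≤ δ * p ∧
        (∀ m : ℤ, |m| ≤ D → m ≠ 0 → ∀ (x : ZMod p) (u v : ZMod p → ℂ),
          (∀ y, ‖u y‖ ≤ 1) → (∀ y, ‖v y‖ ≤ 1) →
          ‖∑ α ∈ B, ∑ β ∈ B, F₃ (x + m * (α - β)) * u α * v β‖ ≤ δ * (B.card : ℝ) ^ 2) := by
  classical
  have hbohr : ∀ η : ℝ, ∃ κ : ℝ, 0 < κ ∧ (0 < η → ∀ (p : ℕ) [Fact p.Prime] (Λ : Finset (ZMod p)),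
      Λ.card ≤ ⌊1 / η ^ 2⌋₊ → ∃ B : Finset (ZMod p), κ * p ≤ B.card ∧ ∀ a ∈ B, ∀ b ∈ B, ∀ r ∈ Λ,
        ‖(ZMod.stdAddChar (r * (a - b)) : ℂ) - 1‖ ≤ δ * η ^ 2 / (2 * D + 1)) := by
    intro η
    by_cases hη : 0 < η
    · obtain ⟨κ, h1, h2⟩ := exists_bohr_fiber (ρ := δ * η ^ 2 / (2 * D + 1)) (by positivity)
        ⌊1 / η ^ 2⌋₊
      exact ⟨κ, h1, fun _ => h2⟩
    · exact ⟨1, one_pos, fun h => absurd h hη⟩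
  choose κ hκ hB using hbohr
  obtain ⟨η, hη0, hηs⟩ : ∃ η : ℕ → ℝ, η 0 = 1 ∧ ∀ j, η (j + 1) = min (η j) (δ * κ (η j)) :=
    ⟨fun j => Nat.rec 1 (fun _ e => min e (δ * κ e)) j, rfl, fun _ => rfl⟩
  have hηpos : ∀ j, 0 < η j := by
    intro j
    induction j with
    | zero => rw [hη0]; exact one_pos
    | succ j ih => rw [hηs]; exact lt_min ih (mul_pos hδ (hκ _))
  obtain ⟨N, hN⟩ := exists_nat_ge (1 / δ ^ 2)
  have hN' : 1 ≤ N * δ ^ 2 := by rwa [div_le_iff₀ (by positivity)] at hN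
  refine ⟨D + 1 + ∑ j ∈ Finset.range N, (⌈1 / κ (η j)⌉₊ + 1), ?_⟩
  intro p _ hp f hf
  let a : ZMod p → ℂ := fourierCoef f
  let Λ : ℕ → Finset (ZMod p) := fun j => {r | η j ≤ ‖a r‖}
  have hmem : ∀ j r, r ∈ Λ j ↔ η j ≤ ‖a r‖ := fun j r => by
    simp only [Λ, Finset.mem_filter, Finset.mem_univ, true_and]
  have hΛsub : ∀ j, Λ j ⊆ Λ (j + 1) := by
    intro j r hr
    rw [hmem] at hr ⊢
    rw [hηs]
    exact (min_le_left _ _).trans hr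
  have ha1 := sum_norm_sq_fourierCoef_le f hf
  have hsum_le : ∀ s : Finset (ZMod p), ∑ r ∈ s, ‖a r‖ ^ 2 ≤ 1 := fun s =>
    (Finset.sum_le_univ_sum_of_nonneg fun r => by positivity).trans ha1
  obtain ⟨j, hjN, hj⟩ : ∃ j < N,
      ∑ r ∈ Λ (j + 1), ‖a r‖ ^ 2 - ∑ r ∈ Λ j, ‖a r‖ ^ 2 ≤ δ ^ 2 := by
    by_contra! hcon
    have h1 := Finset.sum_range_sub (fun j => ∑ r ∈ Λ j, ‖a r‖ ^ 2) N
    have h0 : 0 ≤ ∑ r ∈ Λ 0, ‖a r‖ ^ 2 := by positivity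
    have h2 := hsum_le (Λ N)
    rcases Nat.eq_zero_or_pos N with rfl | hNpos
    · norm_num at hN'
    · have h3 : ∑ _j ∈ Finset.range N, δ ^ 2 < ∑ j ∈ Finset.range N,
          (∑ r ∈ Λ (j + 1), ‖a r‖ ^ 2 - ∑ r ∈ Λ j, ‖a r‖ ^ 2) :=
        Finset.sum_lt_sum_of_nonempty (by simpa using hNpos.ne')
          fun j hj => hcon j (Finset.mem_range.mp hj)
      rw [h1, Finset.sum_const, Finset.card_range, nsmul_eq_mul] at h3
      linarith
  have hcard : ((Λ j).card : ℝ) * η j ^ 2 ≤ 1 := by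
    rw [← nsmul_eq_mul]
    refine le_trans ?_ (hsum_le (Λ j))
    refine Finset.card_nsmul_le_sum _ _ _ fun r hr => ?_
    have := (hmem j r).mp hr
    have := (hηpos j).le
    gcongr
  obtain ⟨B, hBcard, hBchar⟩ := hB (η j) (hηpos j) p (Λ j) (by
    refine Nat.le_floor ?_
    rw [le_div_iff₀ (pow_pos (hηpos j) 2)]
    exact hcard)
  have hpge : D + 1 + (⌈1 / κ (η j)⌉₊ + 1) ≤ p := by
    refine le_trans (Nat.add_le_add_left ?_ _) hp
    exact Finset.single_le_sum (f := fun j => ⌈1 / κ (η j)⌉₊ + 1) (fun _ _ => Nat.zero_le _)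
      (Finset.mem_range.mpr hjN)
  have hκp : 1 < κ (η j) * p := by
    have h1 : (⌈1 / κ (η j)⌉₊ : ℝ) < p := by exact_mod_cast (by omega : ⌈1 / κ (η j)⌉₊ < p)
    have h2 := (Nat.le_ceil (1 / κ (η j))).trans_lt h1
    rw [div_lt_iff₀ (hκ _)] at h2
    linarith
  refine ⟨trigPoly fun r => if r ∈ Λ j then a r else 0,
    trigPoly fun r => if r ∈ Λ (j + 1) \ Λ j then a r else 0,
    trigPoly fun r => if r ∈ Λ (j + 1) then 0 else a r, B, ?_, ?_, ?_, ?_, ?_⟩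
  · exact_mod_cast hκp.trans_le hBcard
  · intro x
    rw [← trigPoly_fourierCoef f x]
    simp only [trigPoly, ← Finset.sum_add_distrib, ← add_mul]
    refine Finset.sum_congr rfl fun r _ => ?_
    congr 1
    by_cases h1 : r ∈ Λ j
    · simp [h1, hΛsub j h1, a]
    · by_cases h2 : r ∈ Λ (j + 1) <;> simp [h1, h2, a]
  · intro s m hs hm b₁ hb₁ b₂ hb₂ b₃ hb₃ b₄ hb₄ x
    have hs' : |(s : ℝ)| ≤ D := by exact_mod_cast hs
    have hm' : |(m : ℝ)| ≤ D := by exact_mod_cast hm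
    have hη2 : 0 ≤ δ * η j ^ 2 / (2 * D + 1) := by positivity
    refine (norm_trigPoly_add_sub_le _ (Λ j) (ρ := δ * η j ^ 2) ?_ ?_ _ _ ?_).trans ?_
    · intro r
      split_ifs
      · exact norm_fourierCoef_le_one f hf r
      · simp
    · intro r hr
      simp [hr]
    · intro r hr
      have h3 : r * (s * (b₁ - b₂) + m * (b₃ - b₄))
          = s * (r * (b₁ - b₂)) + m * (r * (b₃ - b₄)) := by ring
      rw [h3]
      calc _ ≤ _ := norm_stdAddChar_add_sub_one_le _ _
        _ ≤ _ := add_le_add (norm_stdAddChar_int_mul_sub_one_le _ _)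
          (norm_stdAddChar_int_mul_sub_one_le _ _)
        _ ≤ D * (δ * η j ^ 2 / (2 * D + 1)) + D * (δ * η j ^ 2 / (2 * D + 1)) :=
          add_le_add
            (mul_le_mul hs' (hBchar _ hb₁ _ hb₂ r hr) (norm_nonneg _) (by positivity))
            (mul_le_mul hm' (hBchar _ hb₃ _ hb₄ r hr) (norm_nonneg _) (by positivity))
        _ ≤ (2 * D + 1) * (δ * η j ^ 2 / (2 * D + 1)) := by linarith
        _ = δ * η j ^ 2 := by field_simp
    · calc ((Λ j).card : ℝ) * (δ * η j ^ 2) = δ * ((Λ j).card * η j ^ 2) := by ring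
        _ ≤ δ * 1 := by gcongr
        _ = δ := mul_one δ
  · refine sum_norm_trigPoly_le _ hδ.le (le_trans (le_of_eq ?_) hj)
    rw [← Finset.sum_sdiff (hΛsub j), add_sub_cancel_right]
    simp only [apply_ite norm, norm_zero, ite_pow, ne_eq, OfNat.ofNat_ne_zero, not_false_eq_true,
      zero_pow, Finset.sum_ite_mem, Finset.univ_inter]
  · intro m hm hm0 x u v hu hv
    have hmp : (m : ZMod p) ≠ 0 := by
      rw [Ne, ZMod.intCast_zmod_eq_zero_iff_dvd]
      intro hdvd
      have := Int.le_of_dvd (abs_pos.mpr hm0) ((dvd_abs _ _).mpr hdvd)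
      omega
    refine (norm_bilinear_trigPoly_le B _ u v (hηpos (j + 1)).le ?_ hu hv m hmp x).trans ?_
    · intro r
      split_ifs with hr
      · simpa using (hηpos (j + 1)).le
      · rw [hmem] at hr
        exact (not_le.mp hr).le
    · calc η (j + 1) * p * B.card ≤ δ * κ (η j) * p * B.card := by
            rw [hηs]
            gcongr
            exact min_le_right _ _
        _ = δ * (κ (η j) * p) * B.card := by ring
        _ ≤ δ * B.card * B.card := by gcongr
        _ = δ * (B.card : ℝ) ^ 2 := by ring

section Counting

variable {ι G : Type*} [Fintype ι] [DecidableEq ι]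

theorem card_nsmul_sum_piFinset {M : Type*} [AddCommMonoid M] (B : Finset G) (i : ι)
    (Φ : (ι → G) → M) :
    B.card • ∑ e ∈ Fintype.piFinset fun _ => B, Φ e
      = ∑ e ∈ Fintype.piFinset fun _ => B, ∑ a ∈ B, Φ (Function.update e i a) := by
  rw [← Finset.sum_nsmul]
  simp_rw [← Finset.sum_const]
  rw [← Finset.sum_product', ← Finset.sum_product']
  refine Finset.sum_nbij' (fun q => (Function.update q.1 i q.2, q.1 i))
    (fun q => (Function.update q.1 i q.2, q.1 i)) ?_ ?_ ?_ ?_ ?_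
  · rintro ⟨e, a⟩ h
    simp only [Finset.mem_product, Fintype.mem_piFinset] at h ⊢
    refine ⟨fun j => ?_, h.1 i⟩
    rcases eq_or_ne j i with rfl | hj
    · simpa using h.2
    · simpa [hj] using h.1 j
  · rintro ⟨e, a⟩ h
    simp only [Finset.mem_product, Fintype.mem_piFinset] at h ⊢
    refine ⟨fun j => ?_, h.1 i⟩
    rcases eq_or_ne j i with rfl | hj
    · simpa using h.2
    · simpa [hj] using h.1 j
  all_goals simp

theorem card_nsmul_card_nsmul_sum_piFinset {M : Type*} [AddCommMonoid M] (B : Finset G) (i j : ι)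
    (Φ : (ι → G) → M) :
    B.card • B.card • ∑ e ∈ Fintype.piFinset fun _ => B, Φ e
      = ∑ e ∈ Fintype.piFinset fun _ => B, ∑ a ∈ B, ∑ b ∈ B,
        Φ (Function.update (Function.update e j b) i a) := by
  rw [card_nsmul_sum_piFinset B i, card_nsmul_sum_piFinset B j]
  exact Finset.sum_congr rfl fun e _ => Finset.sum_comm

/-- If `Q` is small when tested against products on `B × B`, it stays small in the coordinates
`i, j` when tested against products on `B ^ ι` none of whose factors depends on both. -/
theorem norm_sum_piFinset_le {B : Finset G} (hB : B.Nonempty) {i j : ι} (hij : i ≠ j)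
    (Q : G → G → ℂ) (U V : (ι → G) → ℂ) (hU : ∀ e, ‖U e‖ ≤ 1) (hV : ∀ e, ‖V e‖ ≤ 1)
    (hUj : ∀ e b, U (Function.update e j b) = U e) (hVi : ∀ e a, V (Function.update e i a) = V e)
    {K : ℝ} (hQ : ∀ u v : G → ℂ, (∀ y, ‖u y‖ ≤ 1) → (∀ y, ‖v y‖ ≤ 1) →
      ‖∑ a ∈ B, ∑ b ∈ B, Q a b * u a * v b‖ ≤ K * (B.card : ℝ) ^ 2) :
    ‖∑ e ∈ Fintype.piFinset fun _ => B, Q (e i) (e j) * (U e * V e)‖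
      ≤ K * (Fintype.piFinset fun _ : ι => B).card := by
  have hB' : (0 : ℝ) < B.card := by exact_mod_cast hB.card_pos
  have h := card_nsmul_card_nsmul_sum_piFinset B i j fun e => Q (e i) (e j) * (U e * V e)
  have hnorm := congrArg norm h
  simp only [nsmul_eq_mul, norm_mul, Complex.norm_natCast] at hnorm
  have hle : ‖∑ e ∈ Fintype.piFinset fun _ : ι => B, ∑ a ∈ B, ∑ b ∈ B,
      Q (Function.update (Function.update e j b) i a i)
        (Function.update (Function.update e j b) i a j)
        * (U (Function.update (Function.update e j b) i a)
          * V (Function.update (Function.update e j b) i a))‖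
      ≤ (Fintype.piFinset fun _ : ι => B).card * (K * (B.card : ℝ) ^ 2) := by
    rw [← nsmul_eq_mul]
    refine (norm_sum_le_of_le _ fun e _ => ?_).trans_eq (Finset.sum_const _)
    refine le_of_eq_of_le (congrArg norm ?_) (hQ (fun a => U (Function.update e i a))
      (fun b => V (Function.update e j b)) (fun _ => hU _) (fun _ => hV _))
    refine Finset.sum_congr rfl fun a _ => Finset.sum_congr rfl fun b _ => ?_
    rw [hVi, Function.update_comm hij.symm, hUj, Function.update_self,
      Function.update_of_ne hij, Function.update_self]
    ring
  rw [← hnorm] at hle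
  have h3 : (B.card : ℝ) ^ 2 * ‖∑ e ∈ Fintype.piFinset fun _ => B, Q (e i) (e j) * (U e * V e)‖
      ≤ (B.card : ℝ) ^ 2 * (K * (Fintype.piFinset fun _ : ι => B).card) := by
    linarith
  exact le_of_mul_le_mul_left h3 (by positivity)

theorem sum_piFinset_le {B : Finset G} (hB : B.Nonempty) {i j : ι} (hij : i ≠ j)
    (Q : G → G → ℝ) {K : ℝ} (hQ : ∑ a ∈ B, ∑ b ∈ B, Q a b ≤ K * (B.card : ℝ) ^ 2) :
    ∑ e ∈ Fintype.piFinset fun _ => B, Q (e i) (e j)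
      ≤ K * (Fintype.piFinset fun _ : ι => B).card := by
  have hB' : (0 : ℝ) < B.card := by exact_mod_cast hB.card_pos
  have h := card_nsmul_card_nsmul_sum_piFinset B i j fun e => Q (e i) (e j)
  simp only [nsmul_eq_mul, Function.update_self, Function.update_of_ne hij.symm,
    Finset.sum_const] at h
  have h3 : (B.card : ℝ) ^ 2 * ∑ e ∈ Fintype.piFinset fun _ => B, Q (e i) (e j)
      ≤ (B.card : ℝ) ^ 2 * (K * (Fintype.piFinset fun _ : ι => B).card) := by
    calc _ = (Fintype.piFinset fun _ : ι => B).card * ∑ a ∈ B, ∑ b ∈ B, Q a b := by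
          rw [← h]; ring
      _ ≤ (Fintype.piFinset fun _ : ι => B).card * (K * (B.card : ℝ) ^ 2) := by gcongr
      _ = _ := by ring
  exact le_of_mul_le_mul_left h3 (by positivity)

end Counting

/-- Counting lemma along a permutation `σ` without cycles of length at most two: if near every
`x i` the function `f` is a positive constant up to negligible errors, then the product of the
translates of `f` does not vanish identically on `B ^ ι`. -/
theorem exists_forall_ne_zero {ι R : Type*} [Fintype ι] [LinearOrder ι] [CommRing R]
    (σ : Equiv.Perm ι) (hσ : ∀ i, σ i ≠ i) (hσσ : ∀ i, σ (σ i) ≠ i) {B : Finset R}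
    (hB : B.Nonempty) (x m : ι → R) (g : ι → ℝ) {τ δ : ℝ} (hτ : 0 < τ)
    (hg : ∀ i, τ ≤ g i) (hg1 : ∀ i, g i ≤ 1) {f F₁ F₂ F₃ : R → ℂ} (hf : ∀ y, ‖f y‖ ≤ 1)
    (hsum : ∀ y, f y = F₁ y + F₂ y + F₃ y)
    (h₁ : ∀ i, ∀ a ∈ B, ∀ b ∈ B, ‖F₁ (x i + m i * (a - b)) - g i‖ ≤ 4 * δ)
    (h₂ : ∀ i, ∑ a ∈ B, ∑ b ∈ B, ‖F₂ (x i + m i * (a - b))‖ ≤ δ * (B.card : ℝ) ^ 2)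
    (h₃ : ∀ i, ∀ u v : R → ℂ, (∀ y, ‖u y‖ ≤ 1) → (∀ y, ‖v y‖ ≤ 1) →
      ‖∑ a ∈ B, ∑ b ∈ B, F₃ (x i + m i * (a - b)) * u a * v b‖ ≤ δ * (B.card : ℝ) ^ 2)
    (hδ : Fintype.card ι * (6 * δ) < τ ^ Fintype.card ι) :
    ∃ e : ι → R, ∀ i, f (x i + m i * (e i - e (σ i))) ≠ 0 := by
  by_contra! hcon
  set S := Fintype.piFinset fun _ : ι => B with hS
  have hScard : (0 : ℝ) < S.card := by
    exact_mod_cast (Fintype.piFinset_nonempty.mpr fun _ => hB).card_pos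
  let y : (ι → R) → ι → R := fun e i => x i + m i * (e i - e (σ i))
  have hgn : ∀ i, ‖(g i : ℂ)‖ ≤ 1 := fun i => by
    rw [Complex.norm_real, Real.norm_eq_abs, abs_of_nonneg (hτ.le.trans (hg i))]
    exact hg1 i
  let W : (ι → R) → ι → ℂ := fun e i =>
    (∏ j with j < i, (g j : ℂ)) * ∏ j with i < j, f (y e j)
  have hW : ∀ e i, ‖W e i‖ ≤ 1 := by
    intro e i
    rw [norm_mul]
    refine mul_le_one₀ ?_ (norm_nonneg _) ?_ <;> rw [norm_prod]
    · exact Finset.prod_le_one (fun _ _ => norm_nonneg _) fun _ _ => hgn _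
    · exact Finset.prod_le_one (fun _ _ => norm_nonneg _) fun _ _ => hf _
  have htel : ∀ e, ∏ i, (g i : ℂ) = - ∑ i, (f (y e i) - g i) * W e i := by
    intro e
    have h := Finset.prod_sub_ordered Finset.univ (fun i => f (y e i)) fun i => f (y e i) - g i
    simp only [sub_sub_cancel] at h
    obtain ⟨i, hi⟩ := hcon e
    rw [h, Finset.prod_eq_zero (Finset.mem_univ i) hi, zero_sub]
    congr 1
    exact Finset.sum_congr rfl fun i _ => mul_assoc _ _ _
  have hbound : ∀ i, ‖∑ e ∈ S, (f (y e i) - g i) * W e i‖ ≤ 6 * δ * S.card := by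
    intro i
    have e1 : ‖∑ e ∈ S, (F₁ (y e i) - g i) * W e i‖ ≤ 4 * δ * S.card := by
      rw [mul_comm, ← nsmul_eq_mul]
      refine (norm_sum_le_of_le _ fun e he => ?_).trans_eq (Finset.sum_const _)
      rw [hS, Fintype.mem_piFinset] at he
      rw [norm_mul]
      exact (mul_le_of_le_one_right (norm_nonneg _) (hW e i)).trans (h₁ i _ (he _) _ (he _))
    have e2 : ‖∑ e ∈ S, F₂ (y e i) * W e i‖ ≤ δ * S.card := by
      refine (norm_sum_le_of_le _ fun e _ => ?_).trans
        (sum_piFinset_le hB (hσ i).symm (fun a b => ‖F₂ (x i + m i * (a - b))‖) (h₂ i))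
      rw [norm_mul]
      exact mul_le_of_le_one_right (norm_nonneg _) (hW e i)
    have e3 : ‖∑ e ∈ S, F₃ (y e i) * W e i‖ ≤ δ * S.card := by
      let U : (ι → R) → ℂ := fun e => (∏ j with j < i, (g j : ℂ)) *
        ∏ j ∈ (Finset.univ.filter (i < ·)).erase (σ i), f (y e j)
      let V : (ι → R) → ℂ := fun e => if i < σ i then f (y e (σ i)) else 1
      have hUV : ∀ e, W e i = U e * V e := by
        intro e
        simp only [W, U, V]
        split_ifs with h
        · rw [mul_assoc, Finset.prod_erase_mul _ _ (by simpa using h)]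
        · rw [Finset.erase_eq_of_notMem (by simpa using h), mul_one]
      simp_rw [hUV]
      refine norm_sum_piFinset_le hB (hσ i).symm (fun a b => F₃ (x i + m i * (a - b))) U V
        ?_ ?_ ?_ ?_ (h₃ i)
      · intro e
        simp only [U]
        rw [norm_mul]
        refine mul_le_one₀ ?_ (norm_nonneg _) ?_ <;> rw [norm_prod]
        · exact Finset.prod_le_one (fun _ _ => norm_nonneg _) fun _ _ => hgn _
        · exact Finset.prod_le_one (fun _ _ => norm_nonneg _) fun _ _ => hf _
      · intro e
        simp only [V]
        split_ifs
        · exact hf _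
        · simp
      · intro e b
        simp only [U]
        congr 1
        refine Finset.prod_congr rfl fun j hj => ?_
        simp only [Finset.mem_erase, Finset.mem_filter, Finset.mem_univ, true_and] at hj
        have hj' : σ j ≠ σ i := fun h => hj.2.ne' (σ.injective h)
        simp only [y, Function.update_of_ne hj.1, Function.update_of_ne hj']
      · intro e a
        simp only [V, y, Function.update_of_ne (hσ i), Function.update_of_ne (hσσ i)]
    have hsplit : ∑ e ∈ S, (f (y e i) - g i) * W e i = ∑ e ∈ S, (F₁ (y e i) - g i) * W e i
        + ∑ e ∈ S, F₂ (y e i) * W e i + ∑ e ∈ S, F₃ (y e i) * W e i := by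
      rw [← Finset.sum_add_distrib, ← Finset.sum_add_distrib]
      refine Finset.sum_congr rfl fun e _ => ?_
      rw [hsum]
      ring
    rw [hsplit]
    refine norm_add₃_le.trans ?_
    linarith
  have htot : (S.card : ℂ) * ∏ i, (g i : ℂ) = - ∑ i, ∑ e ∈ S, (f (y e i) - g i) * W e i := by
    rw [Finset.sum_comm, ← Finset.sum_neg_distrib, ← Finset.sum_congr rfl fun e _ => htel e,
      Finset.sum_const, nsmul_eq_mul]
  have hn := congrArg norm htot
  rw [norm_mul, norm_neg, Complex.norm_natCast, norm_prod] at hn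
  have hlow : τ ^ Fintype.card ι ≤ ∏ i, ‖(g i : ℂ)‖ := by
    rw [← Finset.card_univ, ← Finset.prod_const]
    refine Finset.prod_le_prod (fun _ _ => hτ.le) fun i _ => ?_
    rw [Complex.norm_real]
    exact (hg i).trans (le_abs_self _)
  have hup : ‖∑ i, ∑ e ∈ S, (f (y e i) - g i) * W e i‖ ≤ Fintype.card ι * (6 * δ * S.card) := by
    rw [← nsmul_eq_mul, ← Finset.card_univ]
    exact (norm_sum_le_of_le _ fun i _ => hbound i).trans_eq (Finset.sum_const _)
  have : S.card * τ ^ Fintype.card ι ≤ S.card * (Fintype.card ι * (6 * δ)) :=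
    calc S.card * τ ^ Fintype.card ι ≤ S.card * ∏ i, ‖(g i : ℂ)‖ := by gcongr
      _ ≤ Fintype.card ι * (6 * δ * S.card) := hn.trans_le hup
      _ = _ := by ring
  exact absurd (le_of_mul_le_mul_left this hScard) (not_le.mpr hδ)

theorem exists_perm_fin {t : ℕ} (ht : 3 ≤ t) :
    ∃ σ : Equiv.Perm (Fin t), ∀ i, σ i ≠ i ∧ σ (σ i) ≠ i := by
  obtain ⟨k, rfl⟩ := Nat.exists_eq_add_of_le' ht
  refine ⟨Equiv.addRight 1, fun i => ⟨?_, ?_⟩⟩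
  · simp
  · change i + 1 + 1 ≠ i
    rw [add_assoc, Ne, add_eq_left, Fin.ext_iff]
    simp [Fin.val_add, Nat.mod_eq_of_lt]

/-- A set `A` satisfying the robust form of `𝓕`-freeness: no form takes a value `k * u` with
`|k| ≤ C` on `A`. -/
def IsRobustlyFree {p n : ℕ} {t : Fin n → ℕ} (c : ∀ i, Fin (t i) → ℤ) (C : ℕ) (u : ZMod p)
    (A : Finset (ZMod p)) : Prop :=
  ∀ i, ∀ x : Fin (t i) → ZMod p, (∀ j, x j ∈ A) → ∀ k : ℤ, |k| ≤ C →
    ∑ j, c i j • x j ≠ (k : ZMod p) * u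

set_option maxHeartbeats 1000000 in
/-- Every `𝓕`-free subset of `ℤ/p` is nearly as small as some robustly `𝓕`-free one. -/
theorem exists_robustlyFree {n : ℕ} {t : Fin n → ℕ} (c : ∀ i, Fin (t i) → ℤ)
    (hc : ∀ i j, c i j ≠ 0) (ht : ∀ i, 3 ≤ t i) (C : ℕ) {ε : ℝ} (hε : 0 < ε) (hε1 : ε ≤ 1) :
    ∃ P : ℕ, ∀ (p : ℕ) [Fact p.Prime], P ≤ p → ∀ A : Finset (ZMod p),
      (∀ i, IsLFree (c i) (A : Set (ZMod p))) → ∃ (A' : Finset (ZMod p)) (u : ZMod p), u ≠ 0 ∧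
        (A.card : ℝ) ≤ A'.card + ε * p ∧ IsRobustlyFree c C u A' := by
  classical
  set M : ℤ := ∏ i, ∏ j, c i j with hM
  have hM0 : M ≠ 0 := Finset.prod_ne_zero_iff.mpr fun i _ =>
    Finset.prod_ne_zero_iff.mpr fun j _ => hc i j
  have hdvd : ∀ i j, ∃ m : ℤ, M = c i j * m := fun i j =>
    (Finset.dvd_prod_of_mem (c i) (Finset.mem_univ j)).trans
      (Finset.dvd_prod_of_mem (fun i => ∏ j, c i j) (Finset.mem_univ i))
  choose m hm using hdvd
  have hm0 : ∀ i j, m i j ≠ 0 := fun i j h => hM0 (by rw [hm i j, h, mul_zero])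
  have hmM : ∀ i j, |m i j| ≤ |M| := fun i j => by
    rw [hm i j, abs_mul]
    exact le_mul_of_one_le_left (abs_nonneg _) (Int.one_le_abs (hc i j))
  have hM1 : 1 ≤ |M| := Int.one_le_abs hM0
  set D : ℕ := (C + 1) * M.natAbs with hD
  have hDM : (D : ℤ) = (C + 1) * |M| := by simp [hD]
  have hMD : |M| ≤ D := by rw [hDM]; nlinarith
  have hCD : C * |M| ≤ D := by rw [hDM]; nlinarith
  set T : ℕ := ∑ i, t i with hT
  have htT : ∀ i, t i ≤ T := fun i => Finset.single_le_sum (fun _ _ => Nat.zero_le _)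
    (Finset.mem_univ i)
  set τ : ℝ := ε / 2 with hτ
  have hτ0 : 0 < τ := by positivity
  have hτ1 : τ ≤ 1 := by linarith
  set δ : ℝ := τ ^ T / (6 * T + 1) with hδ
  have hδ0 : 0 < δ := by positivity
  have hδT : ∀ i, (t i : ℝ) * (6 * δ) < τ ^ t i := by
    intro i
    have h1 : (t i : ℝ) ≤ T := by exact_mod_cast htT i
    calc (t i : ℝ) * (6 * δ) ≤ T * (6 * δ) := by gcongr
      _ < (6 * T + 1) * δ := by linarith
      _ = τ ^ T := by rw [hδ]; field_simp
      _ ≤ τ ^ t i := pow_le_pow_of_le_one hτ0.le hτ1 (htT i)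
  set J : Finset (ℤ × ℤ) := Finset.Icc (-(D : ℤ)) D ×ˢ Finset.Icc (-(D : ℤ)) D with hJ
  have hJmem : ∀ s k : ℤ, |s| ≤ D → |k| ≤ D → (s, k) ∈ J := fun s k hs hk => by
    rw [hJ, Finset.mem_product, Finset.mem_Icc, Finset.mem_Icc]
    exact ⟨abs_le.mp hs, abs_le.mp hk⟩
  have hJ0 : (0 : ℝ) < J.card := by
    exact_mod_cast Finset.card_pos.mpr ⟨_, hJmem 0 0 (by simp) (by simp)⟩
  have hJ1 : (1 : ℝ) ≤ J.card := by exact_mod_cast hJ0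
  set δ' : ℝ := δ * (ε / 2) / J.card with hδ'
  have hδ'0 : 0 < δ' := by positivity
  have hδ'δ : δ' ≤ δ := by
    rw [hδ', div_le_iff₀ hJ0]
    nlinarith
  obtain ⟨P, hP⟩ := exists_regularity_decomposition hδ'0 D
  refine ⟨P + D + 1, ?_⟩
  intro p _ hp A hA
  have hp0 : (0 : ℝ) < p := by exact_mod_cast (Fact.out : p.Prime).pos
  let f : ZMod p → ℂ := fun x => if x ∈ A then 1 else 0
  have hf : ∀ x, ‖f x‖ ≤ 1 := fun x => by simp only [f]; split_ifs <;> simp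
  obtain ⟨F₁, F₂, F₃, B, hB1, hsum, hF₁, hF₂, hF₃⟩ := hP p (by omega) f hf
  obtain ⟨b₀, hb₀, b₁, hb₁, hb⟩ := Finset.one_lt_card.mp hB1
  have hBne : B.Nonempty := ⟨b₀, hb₀⟩
  have hBc : (0 : ℝ) < B.card := by exact_mod_cast hBne.card_pos
  set v := b₀ - b₁ with hv
  have hMp : (M : ZMod p) ≠ 0 := by
    rw [Ne, ZMod.intCast_zmod_eq_zero_iff_dvd]
    intro h
    have := Int.le_of_dvd (abs_pos.mpr hM0) ((dvd_abs _ _).mpr h)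
    omega
  let g : ZMod p → ℝ := fun x =>
    (∑ a ∈ B, ∑ b ∈ B, if x + (a - b) ∈ A then (1 : ℝ) else 0) / (B.card : ℝ) ^ 2
  have hg1 : ∀ x, g x ≤ 1 := by
    intro x
    rw [div_le_one (by positivity)]
    calc _ ≤ ∑ a ∈ B, ∑ b ∈ B, (1 : ℝ) :=
          Finset.sum_le_sum fun a _ => Finset.sum_le_sum fun b _ => by split_ifs <;> norm_num
      _ = (B.card : ℝ) ^ 2 := by simp [sq]
  have hgsum : ∑ x, g x = A.card := by
    simp only [g]
    rw [← Finset.sum_div, Finset.sum_comm, div_eq_iff (by positivity)]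
    have h1 : ∀ a ∈ B, ∑ x, ∑ b ∈ B, (if x + (a - b) ∈ A then (1 : ℝ) else 0)
        = ∑ b ∈ B, (A.card : ℝ) := by
      intro a _
      rw [Finset.sum_comm]
      refine Finset.sum_congr rfl fun b _ => ?_
      refine (Equiv.sum_comp (Equiv.addRight (a - b)) fun x =>
        if x ∈ A then (1 : ℝ) else 0).trans ?_
      simp
    rw [Finset.sum_congr rfl h1]
    simp [sq]
    ring
  let loc : ℤ × ℤ → ZMod p → ℝ := fun q x =>
    ∑ a ∈ B, ∑ b ∈ B, ‖F₂ (x + (q.1 * v + q.2 * (a - b)))‖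
  let bad : ℤ × ℤ → Finset (ZMod p) := fun q => {x | δ * (B.card : ℝ) ^ 2 < loc q x}
  have hbad : ∀ q, ((bad q).card : ℝ) ≤ ε / 2 / J.card * p := by
    intro q
    have h1 : ((bad q).card : ℝ) * (δ * (B.card : ℝ) ^ 2) ≤ ∑ x, loc q x := by
      rw [← nsmul_eq_mul]
      refine (Finset.card_nsmul_le_sum _ _ _ fun x hx => ?_).trans
        (Finset.sum_le_univ_sum_of_nonneg (s := bad q) fun x =>
          Finset.sum_nonneg fun a _ => Finset.sum_nonneg fun b _ => norm_nonneg _)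
      simp only [bad, Finset.mem_filter, Finset.mem_univ, true_and] at hx
      exact hx.le
    have h2 : ∑ x, loc q x = (B.card : ℝ) ^ 2 * ∑ x, ‖F₂ x‖ := by
      simp only [loc]
      rw [Finset.sum_comm]
      have h3 : ∀ a ∈ B, ∑ x, ∑ b ∈ B, ‖F₂ (x + (q.1 * v + q.2 * (a - b)))‖
          = ∑ b ∈ B, ∑ x, ‖F₂ x‖ := by
        intro a _
        rw [Finset.sum_comm]
        exact Finset.sum_congr rfl fun b _ =>
          Equiv.sum_comp (Equiv.addRight (q.1 * v + q.2 * (a - b))) fun x => ‖F₂ x‖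
      rw [Finset.sum_congr rfl h3]
      simp only [Finset.sum_const, nsmul_eq_mul]
      ring
    have h4 : (δ * (B.card : ℝ) ^ 2) * (bad q).card
        ≤ (δ * (B.card : ℝ) ^ 2) * (ε / 2 / J.card * p) := by
      calc _ ≤ (B.card : ℝ) ^ 2 * (δ' * p) := by
            rw [mul_comm]
            refine h1.trans ?_
            rw [h2]
            gcongr
        _ = _ := by rw [hδ']; ring
    exact le_of_mul_le_mul_left h4 (by positivity)
  let A' : Finset (ZMod p) := {x | τ ≤ g x ∧ ∀ q ∈ J, x ∉ bad q}
  have hA' : ∀ x, x ∈ A' ↔ τ ≤ g x ∧ ∀ q ∈ J, x ∉ bad q := fun x => by simp [A']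
  have hloc : ∀ x ∈ A', ∀ s k : ℤ, |s| ≤ D → |k| ≤ D → loc (s, k) x ≤ δ * (B.card : ℝ) ^ 2 := by
    intro x hx s k hs hk
    simpa [bad] using ((hA' x).mp hx).2 _ (hJmem s k hs hk)
  have hF₁g : ∀ x ∈ A', ‖F₁ x - g x‖ ≤ 3 * δ := by
    intro x hx
    have hD1 : |(1 : ℤ)| ≤ D := by simpa using hM1.trans hMD
    have e1 : ‖∑ a ∈ B, ∑ b ∈ B, (F₁ (x + (a - b)) - F₁ x)‖ ≤ δ * (B.card : ℝ) ^ 2 := by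
      have : δ * (B.card : ℝ) ^ 2 = ∑ a ∈ B, ∑ b ∈ B, δ := by simp [sq]; ring
      rw [this]
      refine norm_sum_le_of_le _ fun a ha => norm_sum_le_of_le _ fun b hb => ?_
      have := hF₁ 0 1 (by simp) hD1 a ha b hb a ha b hb x
      simp only [Int.cast_zero, zero_mul, Int.cast_one, one_mul, zero_add] at this
      exact this.trans hδ'δ
    have e2 : ‖∑ a ∈ B, ∑ b ∈ B, F₂ (x + (a - b))‖ ≤ δ * (B.card : ℝ) ^ 2 := by
      have := hloc x hx 0 1 (by simp) hD1
      simp only [loc, Int.cast_zero, zero_mul, Int.cast_one, one_mul, zero_add] at this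
      exact (norm_sum_le_of_le _ fun a _ => norm_sum_le _ _).trans this
    have e3 : ‖∑ a ∈ B, ∑ b ∈ B, F₃ (x + (a - b))‖ ≤ δ * (B.card : ℝ) ^ 2 := by
      have := hF₃ 1 hD1 one_ne_zero x (fun _ => 1) (fun _ => 1) (by simp) (by simp)
      simp only [Int.cast_one, one_mul, mul_one] at this
      exact this.trans (by gcongr)
    have hgB : (B.card : ℂ) ^ 2 * (g x : ℂ) = ∑ a ∈ B, ∑ b ∈ B, f (x + (a - b)) := by
      have : (B.card : ℂ) ≠ 0 := by exact_mod_cast hBc.ne'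
      simp only [g, f]
      push_cast
      field_simp
      simp [apply_ite]
    have hid : (B.card : ℂ) ^ 2 * (g x - F₁ x) = ∑ a ∈ B, ∑ b ∈ B, (F₁ (x + (a - b)) - F₁ x)
        + ∑ a ∈ B, ∑ b ∈ B, F₂ (x + (a - b)) + ∑ a ∈ B, ∑ b ∈ B, F₃ (x + (a - b)) := by
      rw [mul_sub, hgB]
      simp only [hsum, Finset.sum_add_distrib, Finset.sum_sub_distrib, Finset.sum_const,
        nsmul_eq_mul]
      ring
    have hn := congrArg norm hid
    rw [norm_mul, norm_pow, Complex.norm_natCast, norm_sub_rev] at hn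
    have h4 : (B.card : ℝ) ^ 2 * ‖F₁ x - g x‖ ≤ (B.card : ℝ) ^ 2 * (3 * δ) := by
      rw [hn]
      refine norm_add₃_le.trans ?_
      linarith
    exact le_of_mul_le_mul_left h4 (by positivity)
  refine ⟨A', M * v, mul_ne_zero hMp (sub_ne_zero.mpr hb), ?_, ?_⟩
  · have hpt : ∀ x, g x ≤ τ + ((if x ∈ A' then (1 : ℝ) else 0)
        + if x ∈ J.biUnion bad then (1 : ℝ) else 0) := by
      intro x
      have := hg1 x
      split_ifs with h1 h2 h2
      · linarith
      · linarith
      · linarith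
      · rw [hA'] at h1
        simp only [Finset.mem_biUnion, not_exists, not_and] at h2
        have : ¬ τ ≤ g x := fun h => h1 ⟨h, h2⟩
        linarith
    have hsum_pt := Finset.sum_le_sum fun x (_ : x ∈ Finset.univ) => hpt x
    rw [hgsum, Finset.sum_add_distrib, Finset.sum_add_distrib] at hsum_pt
    simp only [Finset.sum_const, Finset.card_univ, ZMod.card, nsmul_eq_mul, Finset.sum_ite_mem,
      Finset.univ_inter, mul_one] at hsum_pt
    have hU : ((J.biUnion bad).card : ℝ) ≤ ε / 2 * p := by
      calc ((J.biUnion bad).card : ℝ) ≤ ∑ q ∈ J, ((bad q).card : ℝ) := by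
            exact_mod_cast Finset.card_biUnion_le
        _ ≤ ∑ q ∈ J, ε / 2 / J.card * p := Finset.sum_le_sum fun q _ => hbad q
        _ = ε / 2 * p := by
            rw [Finset.sum_const, nsmul_eq_mul]
            field_simp
    have hpτ : (p : ℝ) * τ = ε / 2 * p := by rw [hτ]; ring
    linarith
  · intro i x hx k hk heq
    obtain ⟨σ, hσ⟩ := exists_perm_fin (ht i)
    let j₀ : Fin (t i) := ⟨0, by have := ht i; omega⟩
    let s : Fin (t i) → ℤ := fun j => if j = j₀ then -(k * m i j₀) else 0
    have hs : ∀ j, |s j| ≤ D := by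
      intro j
      simp only [s]
      split_ifs
      · rw [abs_neg, abs_mul]
        exact (mul_le_mul hk (hmM i j₀) (abs_nonneg _) (by positivity)).trans hCD
      · simp
    have hmD : ∀ j, |m i j| ≤ D := fun j => (hmM i j).trans hMD
    have hy : ∀ j, ∀ a ∈ B, ∀ b ∈ B,
        ‖F₁ (x j + s j * v + m i j * (a - b)) - g (x j)‖ ≤ 4 * δ := by
      intro j a ha b hb
      have h1 := hF₁ (s j) (m i j) (hs j) (hmD j) b₀ hb₀ b₁ hb₁ a ha b hb (x j)
      have h2 := hF₁g (x j) (hx j)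
      rw [add_assoc]
      refine (norm_sub_le_norm_sub_add_norm_sub _ (F₁ (x j)) _).trans ?_
      linarith
    have hy₂ : ∀ j, ∑ a ∈ B, ∑ b ∈ B, ‖F₂ (x j + s j * v + m i j * (a - b))‖
        ≤ δ * (B.card : ℝ) ^ 2 := by
      intro j
      simpa only [loc, add_assoc] using hloc (x j) (hx j) (s j) (m i j) (hs j) (hmD j)
    obtain ⟨e, he⟩ := exists_forall_ne_zero (δ := δ) σ (fun j => (hσ j).1) (fun j => (hσ j).2) hBne
      (fun j => x j + s j * v) (fun j => (m i j : ZMod p)) (fun j => g (x j)) hτ0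
      (fun j => ((hA' _).mp (hx j)).1) (fun j => hg1 _) hf hsum hy hy₂
      (fun j u w hu hw => (hF₃ (m i j) (hmD j) (hm0 i j) _ u w hu hw).trans (by gcongr))
      (by simpa using hδT i)
    refine hA i ⟨fun j => x j + s j * v + m i j * (e j - e (σ j)), fun j => ?_, ?_⟩
    · by_contra h
      exact he j (if_neg h)
    · have hcm : ∀ j, (c i j : ZMod p) * m i j = M := fun j => by
        rw [hm i j]
        push_cast
        ring
      have hexp : ∀ j, c i j • (x j + s j * v + m i j * (e j - e (σ j)))
          = c i j • x j + (if j = j₀ then -(k * (M * v)) else 0) + (M * e j - M * e (σ j)) := by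
        intro j
        rw [zsmul_eq_mul, zsmul_eq_mul, mul_add, ← mul_assoc _ (m i j : ZMod p), hcm, mul_add,
          mul_sub (M : ZMod p)]
        congr 2
        simp only [s]
        split_ifs with h
        · subst h
          rw [← hcm j₀]
          push_cast
          ring
        · simp
      simp_rw [hexp]
      rw [Finset.sum_add_distrib, Finset.sum_add_distrib, Finset.sum_sub_distrib,
        Equiv.sum_comp σ fun j => (M : ZMod p) * e j, heq]
      simp

/-- The index `k` of the arc `(k / p, (k + 1) / p]` of the circle containing `y`. -/
def arcIndex (p : ℕ) (y : UnitAddCircle) : ZMod p :=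
  ((⌈p * (AddCircle.equivIoc 1 0 y : ℝ)⌉ - 1 : ℤ) : ZMod p)

theorem measurableSet_arcIndex_preimage (p : ℕ) (s : Set (ZMod p)) :
    MeasurableSet (arcIndex p ⁻¹' s) := by
  have h : Measurable fun y : UnitAddCircle => ⌈p * (AddCircle.equivIoc 1 0 y : ℝ)⌉ :=
    Int.measurable_ceil.comp
      ((measurable_subtype_coe.comp (AddCircle.measurableEquivIoc (1 : ℝ) 0).measurable).const_mul
        (p : ℝ))
  exact h (MeasurableSet.of_discrete (s := {k : ℤ | ((k - 1 : ℤ) : ZMod p) ∈ s}))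

theorem exists_arcIndex_eq (p : ℕ) [NeZero p] (y : UnitAddCircle) : ∃ (z : ℤ) (θ : ℝ),
    arcIndex p y = z ∧ 0 < θ ∧ θ ≤ 1 ∧ y = (((z + θ) / p : ℝ) : UnitAddCircle) := by
  have hp : (p : ℝ) ≠ 0 := by exact_mod_cast NeZero.ne p
  set w : ℝ := (AddCircle.equivIoc 1 0 y : ℝ) with hw
  refine ⟨⌈p * w⌉ - 1, p * w - (⌈p * w⌉ - 1), rfl, ?_, ?_, ?_⟩
  · linarith [Int.ceil_lt_add_one (p * w)]
  · linarith [Int.le_ceil (p * w)]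
  · have : (((⌈p * w⌉ - 1 : ℤ) : ℝ) + (p * w - (⌈p * w⌉ - 1))) / p = w := by
      push_cast
      field_simp
      ring
    rw [this]
    exact AddCircle.coe_equivIoc.symm

theorem volume_arcIndex_preimage_singleton (p : ℕ) [NeZero p] (a : ZMod p) :
    volume (arcIndex p ⁻¹' {a}) = ENNReal.ofReal (1 / p) := by
  have hp : (0 : ℝ) < p := by exact_mod_cast NeZero.pos p
  rw [AddCircle.add_projection_respects_measure 1 0 (measurableSet_arcIndex_preimage p {a})]
  have hset : (QuotientAddGroup.mk ⁻¹' (arcIndex p ⁻¹' {a}) ∩ Set.Ioc (0 : ℝ) (0 + 1))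
      = Set.Ioc ((a.val : ℝ) / p) ((a.val + 1) / p) := by
    ext x
    simp only [Set.mem_inter_iff, Set.mem_preimage, Set.mem_singleton_iff]
    have key : ∀ hx : x ∈ Set.Ioc (0 : ℝ) (0 + 1),
        arcIndex p (QuotientAddGroup.mk x : UnitAddCircle) = ((⌈p * x⌉ - 1 : ℤ) : ZMod p) := by
      intro hx
      have := AddCircle.equivIoc_coe_of_mem (p := (1 : ℝ)) (a := 0) hx
      exact congrArg (fun w : ℝ => ((⌈p * w⌉ - 1 : ℤ) : ZMod p)) this
    have hval : (a.val : ℝ) + 1 ≤ p := by exact_mod_cast ZMod.val_lt a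
    constructor
    · rintro ⟨h, hx⟩
      rw [key hx] at h
      have h1 : 1 ≤ ⌈p * x⌉ := Int.one_le_ceil_iff.mpr (mul_pos hp hx.1)
      have h2 : ⌈p * x⌉ ≤ p := Int.ceil_le.mpr (by
        have := hx.2
        push_cast
        nlinarith)
      have h3 : ⌈p * x⌉ - 1 = a.val := by
        rw [← h, ZMod.val_intCast, Int.emod_eq_of_lt (by omega) (by omega)]
      have h4 : ⌈p * x⌉ = a.val + 1 := by omega
      rw [Int.ceil_eq_iff] at h4
      push_cast at h4
      rw [Set.mem_Ioc, div_lt_iff₀ hp, le_div_iff₀ hp]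
      constructor <;> linarith [h4.1, h4.2]
    · intro hx
      rw [Set.mem_Ioc, div_lt_iff₀ hp, le_div_iff₀ hp] at hx
      have hx' : x ∈ Set.Ioc (0 : ℝ) (0 + 1) := by
        have : (0 : ℝ) ≤ a.val := Nat.cast_nonneg _
        constructor <;> nlinarith [hx.1, hx.2]
      refine ⟨?_, hx'⟩
      rw [key hx']
      have : ⌈p * x⌉ = (a.val : ℤ) + 1 := by
        rw [Int.ceil_eq_iff]
        push_cast
        constructor <;> linarith [hx.1, hx.2]
      rw [this]
      simp
  rw [hset, Real.volume_Ioc]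
  congr 1
  ring

theorem volume_arcIndex_preimage (p : ℕ) [NeZero p] (A : Finset (ZMod p)) :
    (volume (arcIndex p ⁻¹' (A : Set (ZMod p)))).toReal = (A.card : ℝ) / p := by
  rw [← sum_measure_preimage_singleton A fun a _ => measurableSet_arcIndex_preimage p {a}]
  simp only [volume_arcIndex_preimage_singleton, Finset.sum_const, nsmul_eq_mul,
    ENNReal.toReal_mul, ENNReal.toReal_natCast]
  rw [ENNReal.toReal_ofReal (by positivity)]
  ring

theorem coe_sum_intCast_mul {ι : Type*} [Fintype ι] (c : ι → ℤ) (x : ι → ℝ) :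
    ((∑ j, c j * x j : ℝ) : UnitAddCircle) = ∑ j, c j • (x j : UnitAddCircle) := by
  rw [← QuotientAddGroup.mk'_apply, map_sum]
  refine Finset.sum_congr rfl fun j _ => ?_
  rw [← zsmul_eq_mul, map_zsmul]
  rfl

/-- A robustly `𝓕`-free set lifts to an `𝓕`-free subset of the circle. -/
theorem IsRobustlyFree.isLFree {p n : ℕ} [Fact p.Prime] {t : Fin n → ℕ}
    {c : ∀ i, Fin (t i) → ℤ} {C : ℕ} {u : ZMod p} {A : Finset (ZMod p)}
    (hA : IsRobustlyFree c C u A) (hC : ∀ i, ∑ j, |c i j| ≤ C) (i : Fin n) :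
    IsLFree (c i) (arcIndex p ⁻¹' {a | u * a ∈ A}) := by
  rintro ⟨y, hyA, hy⟩
  have hp : (p : ℝ) ≠ 0 := by exact_mod_cast NeZero.ne p
  choose z θ hz hθ0 hθ1 hyz using fun j => exists_arcIndex_eq p (y j)
  have h1 : ((∑ j, c i j * ((z j + θ j) / p) : ℝ) : UnitAddCircle) = 0 := by
    rw [← hy]
    rw [coe_sum_intCast_mul]
    exact Finset.sum_congr rfl fun j _ => by rw [hyz j]
  obtain ⟨r, hr⟩ := (AddCircle.coe_eq_zero_iff (1 : ℝ)).mp h1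
  have h2 : ∑ j, (c i j : ℝ) * θ j = ((r * p - ∑ j, c i j * z j : ℤ) : ℝ) := by
    have h3 : ∑ j, (c i j : ℝ) * ((z j + θ j) / p)
        = (∑ j, (c i j : ℝ) * z j + ∑ j, (c i j : ℝ) * θ j) / p := by
      rw [← Finset.sum_add_distrib, Finset.sum_div]
      exact Finset.sum_congr rfl fun j _ => by ring
    rw [h3, eq_div_iff hp] at hr
    push_cast
    simp only [zsmul_eq_mul, mul_one] at hr
    linarith
  set k : ℤ := r * p - ∑ j, c i j * z j with hk
  have hkC : |k| ≤ C := by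
    refine le_trans ?_ (hC i)
    have : |(k : ℝ)| ≤ ∑ j, |(c i j : ℝ)| := by
      rw [← h2]
      refine (Finset.abs_sum_le_sum_abs _ _).trans (Finset.sum_le_sum fun j _ => ?_)
      rw [abs_mul, abs_of_pos (hθ0 j)]
      exact mul_le_of_le_one_right (abs_nonneg _) (hθ1 j)
    exact_mod_cast this
  refine hA i (fun j => u * arcIndex p (y j)) hyA (-k) (by rwa [abs_neg]) ?_
  rw [hk]
  push_cast
  simp only [hz, zsmul_eq_mul, CharP.cast_eq_zero, mul_zero, zero_sub, neg_neg, Finset.sum_mul]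
  exact Finset.sum_congr rfl fun j _ => by ring

theorem exists_isLFree_thickening {n : ℕ} {t : Fin n → ℕ} (c : ∀ i, Fin (t i) → ℤ)
    {K : Set UnitAddCircle} (hK : IsCompact K) (hfree : ∀ i, IsLFree (c i) K) :
    ∃ δ > 0, ∀ i, ∀ x y : Fin (t i) → UnitAddCircle, (∀ j, x j ∈ K) →
      (∀ j, dist (y j) (x j) < δ) → ∑ j, c i j • y j ≠ 0 := by
  have hi : ∀ i, ∀ᶠ δ : ℝ in nhdsWithin 0 (Set.Ioi 0), ∀ x y : Fin (t i) → UnitAddCircle,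
      (∀ j, x j ∈ K) → (∀ j, dist (y j) (x j) < δ) → ∑ j, c i j • y j ≠ 0 := by
    intro i
    have hopen : IsOpen {y : Fin (t i) → UnitAddCircle | ∑ j, c i j • y j ≠ 0} :=
      isOpen_ne_fun (by fun_prop) continuous_const
    obtain ⟨δ, hδ, hsub⟩ := IsCompact.exists_thickening_subset_open
      (isCompact_univ_pi fun _ : Fin (t i) => hK) hopen fun x hx h => hfree i ⟨x, fun j => hx j trivial, h⟩
    filter_upwards [Ioc_mem_nhdsGT hδ] with δ' hδ' x y hx hxy
    refine hsub (Metric.mem_thickening_iff.mpr ⟨x, fun j _ => hx j, ?_⟩)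
    exact (dist_pi_lt_iff hδ).mpr fun j => (hxy j).trans_le hδ'.2
  obtain ⟨δ, h, hδ⟩ := ((Filter.eventually_all.mpr hi).and self_mem_nhdsWithin).exists
  exact ⟨δ, hδ, h⟩

theorem toReal_volume_le_dF {n : ℕ} {t : Fin n → ℕ} {c : ∀ i, Fin (t i) → ℤ}
    {A : Set UnitAddCircle} (hA : MeasurableSet A) (hfree : ∀ i, IsLFree (c i) A) :
    (volume A).toReal ≤ dF (volume : Measure UnitAddCircle) c := by
  refine le_csSup ⟨(volume (Set.univ : Set UnitAddCircle)).toReal, ?_⟩ ⟨A, hA, hfree, rfl⟩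
  rintro _ ⟨B, -, -, rfl⟩
  exact ENNReal.toReal_mono (measure_ne_top _ _) (measure_mono (Set.subset_univ B))

theorem card_div_le_dZ {p n : ℕ} [NeZero p] {t : Fin n → ℕ} {c : ∀ i, Fin (t i) → ℤ}
    {A : Finset (ZMod p)} (hfree : ∀ i, IsLFree (c i) (A : Set (ZMod p))) :
    (A.card : ℝ) / p ≤ dZ p c := by
  refine le_csSup ⟨(Nat.card (ZMod p) : ℝ) / p, ?_⟩ ⟨A, hfree, by simp⟩
  rintro _ ⟨B, -, rfl⟩
  gcongr
  exact Finite.card_subtype_le _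

theorem isLFree_empty {G : Type*} [AddCommGroup G] {t : ℕ} (ht : 0 < t) (c : Fin t → ℤ) :
    IsLFree c (∅ : Set G) :=
  fun ⟨_, hx, _⟩ => hx ⟨0, ht⟩

theorem dF_pos {n : ℕ} {t : Fin n → ℕ} (c : ∀ i, Fin (t i) → ℤ) (hinv : ∀ i, ∑ j, c i j ≠ 0) :
    0 < dF (volume : Measure UnitAddCircle) c := by
  have hfree : ∀ i, IsLFree (c i) {((√2 : ℝ) : UnitAddCircle)} := by
    rintro i ⟨x, hx, h⟩
    simp only [Set.mem_singleton_iff] at hx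
    simp only [hx, ← Finset.sum_smul] at h
    rw [← AddCircle.coe_zsmul, AddCircle.coe_eq_zero_iff] at h
    obtain ⟨r, hr⟩ := h
    simp only [zsmul_eq_mul, mul_one] at hr
    exact (irrational_sqrt_two.intCast_mul (hinv i)).ne_int r hr.symm
  obtain ⟨δ, hδ, h⟩ := exists_isLFree_thickening c isCompact_singleton hfree
  refine lt_of_lt_of_le ?_ (toReal_volume_le_dF
    (measurableSet_ball (x := ((√2 : ℝ) : UnitAddCircle)) (ε := δ)) fun i ⟨y, hy, h0⟩ => ?_)
  · exact ENNReal.toReal_pos (Metric.measure_ball_pos _ _ hδ).ne' (measure_ne_top _ _)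
  · exact h i (fun _ => ((√2 : ℝ) : UnitAddCircle)) y (fun _ => rfl) hy h0

theorem exists_dF_le_dZ_add {n : ℕ} {t : Fin n → ℕ} (c : ∀ i, Fin (t i) → ℤ)
    (ht : ∀ i, 3 ≤ t i) {ε : ℝ} (hε : 0 < ε) :
    ∃ N : ℕ, ∀ p : ℕ, p.Prime → N ≤ p →
      dF (volume : Measure UnitAddCircle) c ≤ dZ p c + ε := by
  classical
  have hne : {r : ℝ | ∃ A : Set UnitAddCircle, MeasurableSet A ∧ (∀ i, IsLFree (c i) A) ∧
      r = (volume A).toReal}.Nonempty :=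
    ⟨_, ∅, MeasurableSet.empty, fun i => isLFree_empty (by have := ht i; omega) _, rfl⟩
  obtain ⟨_, ⟨A, hAm, hA, rfl⟩, hAε⟩ := exists_lt_of_lt_csSup hne
    (sub_lt_self (dF (volume : Measure UnitAddCircle) c) (half_pos hε))
  obtain ⟨K, hKA, hK, hKε⟩ := hAm.exists_isCompact_lt_add (measure_ne_top volume A)
    (ε := ENNReal.ofReal (ε / 2)) (by simpa using hε)
  have hKε' : (volume A).toReal ≤ (volume K).toReal + ε / 2 := by
    have := ENNReal.toReal_mono (by finiteness) hKε.le
    rwa [ENNReal.toReal_add (measure_ne_top _ _) ENNReal.ofReal_ne_top,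
      ENNReal.toReal_ofReal (half_pos hε).le] at this
  obtain ⟨δ, hδ, h⟩ := exists_isLFree_thickening c hK
    fun i ⟨x, hx, h0⟩ => hA i ⟨x, fun j => hKA (hx j), h0⟩
  obtain ⟨N, hN⟩ := exists_nat_gt (1 / δ)
  refine ⟨N, fun p hp hNp => ?_⟩
  have : Fact p.Prime := ⟨hp⟩
  have hp0 : (0 : ℝ) < p := by exact_mod_cast hp.pos
  have hpδ : 1 / (p : ℝ) < δ := by
    have : (N : ℝ) ≤ p := by exact_mod_cast hNp
    rw [div_lt_iff₀ hδ] at hN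
    rw [div_lt_iff₀ hp0]
    nlinarith
  let S : Finset (ZMod p) := (arcIndex p '' K).toFinset
  have hS : (S : Set (ZMod p)) = arcIndex p '' K := Set.coe_toFinset _
  have hSfree : ∀ i, IsLFree (c i) (S : Set (ZMod p)) := by
    rintro i ⟨a, ha, h0⟩
    rw [hS] at ha
    choose y hyK hya using ha
    choose z θ hz hθ0 hθ1 hyz using fun j => exists_arcIndex_eq p (y j)
    refine h i y (fun j => ((z j / p : ℝ) : UnitAddCircle)) hyK (fun j => ?_) ?_
    · rw [hyz j, dist_comm, dist_eq_norm, ← AddCircle.coe_sub]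
      refine (QuotientAddGroup.norm_mk_le_norm (m := (z j + θ j) / p - z j / (p : ℝ))).trans_lt
        (lt_of_le_of_lt ?_ hpδ)
      rw [← sub_div, add_sub_cancel_left, norm_div, Real.norm_of_nonneg (hθ0 j).le,
        Real.norm_of_nonneg hp0.le]
      exact div_le_div_of_nonneg_right (hθ1 j) hp0.le
    · have h1 : ((∑ j, c i j * z j : ℤ) : ZMod p) = 0 := by
        rw [← h0]
        push_cast
        exact Finset.sum_congr rfl fun j _ => by rw [← hya j, hz j, zsmul_eq_mul]
      obtain ⟨r, hr⟩ := (ZMod.intCast_zmod_eq_zero_iff_dvd _ p).mp h1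
      rw [← coe_sum_intCast_mul, AddCircle.coe_eq_zero_iff]
      refine ⟨r, ?_⟩
      have hr' : ∑ j, (c i j : ℝ) * z j = p * r := by exact_mod_cast hr
      simp only [← mul_div_assoc, ← Finset.sum_div, hr', zsmul_eq_mul, mul_one]
      field_simp
  have hle : (volume K).toReal ≤ (S.card : ℝ) / p := by
    rw [← volume_arcIndex_preimage, hS]
    exact ENNReal.toReal_mono (measure_ne_top _ _) (measure_mono (Set.subset_preimage_image _ _))
  linarith [hle.trans (card_div_le_dZ hSfree)]

theorem exists_dZ_le_dF_add {n : ℕ} {t : Fin n → ℕ} (c : ∀ i, Fin (t i) → ℤ)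
    (hc : ∀ i j, c i j ≠ 0) (ht : ∀ i, 3 ≤ t i) {ε : ℝ} (hε : 0 < ε) :
    ∃ N : ℕ, ∀ p : ℕ, p.Prime → N ≤ p →
      dZ p c ≤ dF (volume : Measure UnitAddCircle) c + ε := by
  classical
  let C : ℕ := ∑ i, ∑ j, (c i j).natAbs
  have hC : ∀ i, ∑ j, |c i j| ≤ C := by
    intro i
    simp only [C, Nat.cast_sum, Int.natCast_natAbs]
    exact Finset.single_le_sum (f := fun i => ∑ j, |c i j|)
      (fun i _ => Finset.sum_nonneg fun j _ => abs_nonneg _) (Finset.mem_univ i)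
  obtain ⟨N, hN⟩ := exists_robustlyFree c hc ht C (lt_min hε one_pos) (min_le_right ε 1)
  refine ⟨N, fun p hp hNp => ?_⟩
  have : Fact p.Prime := ⟨hp⟩
  have hp0 : (0 : ℝ) < p := by exact_mod_cast hp.pos
  refine csSup_le ⟨_, ∅, fun i => isLFree_empty (by have := ht i; omega) _, rfl⟩ ?_
  rintro _ ⟨A, hA, rfl⟩
  obtain ⟨A', u, hu, hcard, hrob⟩ := hN p hNp A.toFinset (by simpa using hA)
  have himage : ((A'.image fun a => u⁻¹ * a : Finset (ZMod p)) : Set (ZMod p))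
      = {a | u * a ∈ A'} := by
    ext a
    simp only [Finset.coe_image, Set.mem_image, Finset.mem_coe, Set.mem_ofPred_eq]
    constructor
    · rintro ⟨b, hb, rfl⟩
      rwa [mul_inv_cancel_left₀ hu]
    · exact fun ha => ⟨_, ha, inv_mul_cancel_left₀ hu a⟩
  have hvol := volume_arcIndex_preimage p (A'.image fun a => u⁻¹ * a)
  rw [Finset.card_image_of_injective _ (mul_right_injective₀ (inv_ne_zero hu)), himage] at hvol
  have hle := toReal_volume_le_dF (measurableSet_arcIndex_preimage p _) (hrob.isLFree hC)
  rw [hvol] at hle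
  rw [Nat.card_eq_card_toFinset]
  calc (A.toFinset.card : ℝ) / p ≤ (A'.card + min ε 1 * p) / p := by gcongr
    _ = A'.card / p + min ε 1 := by field_simp
    _ ≤ _ := add_le_add hle (min_le_left _ _)

theorem stmt1 {n : ℕ} {t : Fin n → ℕ} (c : ∀ i, Fin (t i) → ℤ)
    (hc : ∀ i j, c i j ≠ 0) (ht : ∀ i, 3 ≤ t i)
    (hinv : ∀ i, ∑ j, c i j ≠ 0) :
    (∀ ε : ℝ, 0 < ε → ∃ N : ℕ, ∀ p : ℕ, p.Prime → N ≤ p →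
      |dZ p c - dF (volume : Measure UnitAddCircle) c| ≤ ε) ∧
    0 < dF (volume : Measure UnitAddCircle) c := by
  refine ⟨fun ε hε => ?_, dF_pos c hinv⟩
  obtain ⟨N₁, h₁⟩ := exists_dF_le_dZ_add c ht hε
  obtain ⟨N₂, h₂⟩ := exists_dZ_le_dF_add c hc ht hε
  refine ⟨max N₁ N₂, fun p hp hN => abs_le.mpr ⟨?_, ?_⟩⟩
  · linarith [h₁ p hp (le_of_max_le_left hN)]
  · linarith [h₂ p hp (le_of_max_le_right hN)]
end
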